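/- arXiv:1508.06123 — 2 statements merged into one kernel-verified Lean document; each statement's English description precedes it below -/
import Mathlib

section
/- Let u: ℝ × ℝ → ℝ be twice continuously differentiable with u(x+1,t) = u(x,t) for all x,t, and suppose u satisfies the sinh-Gordon equation ∂ₓ∂ₜu(x,t) = sinh(u(x,t)) for all x,t. Then for every t one has ∫₀¹ sinh(u(x,t)) dx = 0; moreover, setting v(x,t) := ∂ₓu(x,t)/2, for every t the function v(·,t) is continuous, 1-periodic with ∫₀¹ v(x,t) dx = 0, and one has u(x,t) = 2(∂ₓ⁻¹v(·,t))(x) + c_sh(v(·,t)) for all x,t, as well as ∂ₜv(x,t) = ½ sinh( 2(∂ₓ⁻¹v(·,t))(x) + c_sh(v(·,t)) ) for all x,t. -/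
open MeasureTheory Real intervalIntegral

/-- Inverse hyperbolic tangent on (-1,1). -/
noncomputable def artanh (x : ℝ) : ℝ := (1 / 2) * Real.log ((1 + x) / (1 - x))

/-- The mean-zero antiderivative of a (continuous, 1-periodic, mean-zero) function:
`(∂ₓ⁻¹ f)(x) = ∫₀ˣ f(s) ds − ∫₀¹ ∫₀ʸ f(s) ds dy`. -/
noncomputable def pInv (f : ℝ → ℝ) (x : ℝ) : ℝ :=
  (∫ s in (0:ℝ)..x, f s) - ∫ y in (0:ℝ)..1, ∫ s in (0:ℝ)..y, f s

/-- `c_sh(v) = - artanh ((∫₀¹ sinh (2 ∂ₓ⁻¹v)) / (∫₀¹ cosh (2 ∂ₓ⁻¹v)))`. -/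
noncomputable def cSh (v : ℝ → ℝ) : ℝ :=
  - _root_.artanh ((∫ x in (0:ℝ)..1, Real.sinh (2 * pInv v x)) /
      (∫ x in (0:ℝ)..1, Real.cosh (2 * pInv v x)))

/-- `artanh` is a left inverse of the hyperbolic tangent. -/
theorem artanh_sinh_div_cosh (m : ℝ) : _root_.artanh (Real.sinh m / Real.cosh m) = m := by
  have hc := Real.cosh_pos m
  have h : (1 + Real.sinh m / Real.cosh m) / (1 - Real.sinh m / Real.cosh m)
      = Real.exp (2 * m) := by
    have h1 : (1 + Real.sinh m / Real.cosh m) / (1 - Real.sinh m / Real.cosh m)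
        = (Real.cosh m + Real.sinh m) / (Real.cosh m - Real.sinh m) := by
      rw [one_add_div hc.ne', one_sub_div hc.ne', div_div_div_cancel_right₀ hc.ne']
    rw [h1, Real.cosh_add_sinh, Real.cosh_sub_sinh, ← Real.exp_sub]
    ring_nf
  rw [_root_.artanh, h, Real.log_exp]
  ring

/-- The mean-zero antiderivative of half the derivative of a `C¹` function. -/
theorem two_mul_pInv_half_deriv {g : ℝ → ℝ} (hg : ContDiff ℝ 1 g) (x : ℝ) :
    2 * pInv (fun y => deriv g y / 2) x = g x - ∫ y in (0:ℝ)..1, g y := by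
  have hd : Continuous (deriv g) := hg.continuous_deriv le_rfl
  have hint : ∀ y : ℝ, (∫ s in (0:ℝ)..y, deriv g s / 2) = (g y - g 0) / 2 := fun y => by
    rw [intervalIntegral.integral_div, intervalIntegral.integral_deriv_eq_sub
      (fun z _ => (hg.differentiable one_ne_zero) z) (hd.intervalIntegrable _ _)]
  simp only [pInv, hint]
  rw [intervalIntegral.integral_div, intervalIntegral.integral_sub
    (hg.continuous.intervalIntegrable _ _) (by simp), intervalIntegral.integral_const]
  simp only [sub_zero, one_smul]
  ring

/-- If `sinh g` has mean zero, then `cSh` of half the derivative of `g` is the mean of `g`. -/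
theorem cSh_half_deriv {g : ℝ → ℝ} (hg : ContDiff ℝ 1 g)
    (h0 : ∫ x in (0:ℝ)..1, Real.sinh (g x) = 0) :
    cSh (fun y => deriv g y / 2) = ∫ y in (0:ℝ)..1, g y := by
  simp only [cSh, two_mul_pInv_half_deriv hg]
  set m := ∫ y in (0:ℝ)..1, g y
  have hgc := hg.continuous
  have hsi : IntervalIntegrable (fun x => Real.sinh (g x - m)) volume 0 1 :=
    (Real.continuous_sinh.comp (hgc.sub continuous_const)).intervalIntegrable _ _
  have hcc : Continuous (fun x => Real.cosh (g x - m)) :=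
    Real.continuous_cosh.comp (hgc.sub continuous_const)
  have hci : IntervalIntegrable (fun x => Real.cosh (g x - m)) volume 0 1 :=
    hcc.intervalIntegrable _ _
  have hC : 0 < ∫ x in (0:ℝ)..1, Real.cosh (g x - m) :=
    intervalIntegral.intervalIntegral_pos_of_pos hci (fun x => Real.cosh_pos _) one_pos
  have hsum : (∫ x in (0:ℝ)..1, Real.sinh (g x - m)) * Real.cosh m
      + (∫ x in (0:ℝ)..1, Real.cosh (g x - m)) * Real.sinh m = 0 := by
    rw [← intervalIntegral.integral_mul_const, ← intervalIntegral.integral_mul_const,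
      ← intervalIntegral.integral_add (hsi.mul_const _) (hci.mul_const _)]
    refine (intervalIntegral.integral_congr fun x _ => ?_).trans h0
    simp only [← Real.sinh_add, sub_add_cancel]
  have hq : (∫ x in (0:ℝ)..1, Real.sinh (g x - m)) / (∫ x in (0:ℝ)..1, Real.cosh (g x - m))
      = Real.sinh (-m) / Real.cosh (-m) := by
    rw [Real.sinh_neg, Real.cosh_neg, div_eq_div_iff hC.ne' (Real.cosh_pos m).ne']
    linarith
  rw [hq, artanh_sinh_div_cosh, neg_neg]

section PartialDerivatives

variable {u : ℝ → ℝ → ℝ}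

theorem hasDerivAt_fst_of_differentiable (hu : Differentiable ℝ (Function.uncurry u)) (x t : ℝ) :
    HasDerivAt (fun x' => u x' t) (fderiv ℝ (Function.uncurry u) (x, t) (1, 0)) x :=
  (hu (x, t)).hasFDerivAt.comp_hasDerivAt (l := Function.uncurry u) x
    ((hasDerivAt_id' x).prodMk (hasDerivAt_const x t))

theorem hasDerivAt_snd_of_differentiable (hu : Differentiable ℝ (Function.uncurry u)) (x t : ℝ) :
    HasDerivAt (fun t' => u x t') (fderiv ℝ (Function.uncurry u) (x, t) (0, 1)) t :=
  (hu (x, t)).hasFDerivAt.comp_hasDerivAt (l := Function.uncurry u) t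
    ((hasDerivAt_const t x).prodMk (hasDerivAt_id' t))

/-- The mixed second partial derivatives of a `C²` function agree. -/
theorem deriv_deriv_comm (hu : ContDiff ℝ 2 (Function.uncurry u)) (x t : ℝ) :
    deriv (fun t' => deriv (fun x' => u x' t') x) t
      = deriv (fun x' => deriv (fun t' => u x' t') t) x := by
  have hd := hu.differentiable two_ne_zero
  have hd2 : Differentiable ℝ (fderiv ℝ (Function.uncurry u)) :=
    (hu.fderiv_right (m := 1) (by norm_num)).differentiable one_ne_zero
  have h1 : HasDerivAt (fun t' => fderiv ℝ (Function.uncurry u) (x, t'))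
      (fderiv ℝ (fderiv ℝ (Function.uncurry u)) (x, t) (0, 1)) t :=
    (hd2 (x, t)).hasFDerivAt.comp_hasDerivAt t
      ((hasDerivAt_const t x).prodMk (hasDerivAt_id t))
  have h2 : HasDerivAt (fun x' => fderiv ℝ (Function.uncurry u) (x', t))
      (fderiv ℝ (fderiv ℝ (Function.uncurry u)) (x, t) (1, 0)) x :=
    (hd2 (x, t)).hasFDerivAt.comp_hasDerivAt x
      ((hasDerivAt_id x).prodMk (hasDerivAt_const x t))
  simp only [fun a b => (hasDerivAt_fst_of_differentiable hd a b).deriv,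
    fun a b => (hasDerivAt_snd_of_differentiable hd a b).deriv]
  rw [(h1.clm_apply (hasDerivAt_const t ((1, 0) : ℝ × ℝ))).deriv,
    (h2.clm_apply (hasDerivAt_const x ((0, 1) : ℝ × ℝ))).deriv]
  have hsymm := hu.contDiffAt.isSymmSndFDerivAt (x := (x, t)) (by simp)
  simpa using hsymm.eq (0, 1) (1, 0)

end PartialDerivatives

/-- a classical 1-periodic (in x) solution of the sinh-Gordon equation
`∂ₓ∂ₜ u = sinh u` satisfies `∫₀¹ sinh (u x t) dx = 0` for all `t`; moreover
`v(·,t) := ∂ₓu(·,t)/2` is continuous, 1-periodic and mean-zero,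
`u = 2 ∂ₓ⁻¹ v(·,t) + c_sh(v(·,t))`, and `∂ₜ v = ½ sinh (2 ∂ₓ⁻¹ v(·,t) + c_sh(v(·,t)))`. -/
theorem sinhGordon_reduction (u : ℝ → ℝ → ℝ)
    (hreg : ContDiff ℝ 2 (Function.uncurry u))
    (hper : ∀ x t, u (x + 1) t = u x t)
    (hpde : ∀ x t, deriv (fun x' => deriv (fun t' => u x' t') t) x = Real.sinh (u x t)) :
    (∀ t, (∫ x in (0:ℝ)..1, Real.sinh (u x t)) = 0) ∧
    (∀ t, Continuous (fun x => deriv (fun x' => u x' t) x / 2) ∧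
      Function.Periodic (fun x => deriv (fun x' => u x' t) x / 2) 1 ∧
      (∫ x in (0:ℝ)..1, deriv (fun x' => u x' t) x / 2) = 0) ∧
    (∀ x t, u x t = 2 * pInv (fun y => deriv (fun x' => u x' t) y / 2) x
        + cSh (fun y => deriv (fun x' => u x' t) y / 2)) ∧
    (∀ x t, deriv (fun t' => deriv (fun x' => u x' t') x / 2) t
        = (1 / 2) * Real.sinh (2 * pInv (fun y => deriv (fun x' => u x' t) y / 2) x
            + cSh (fun y => deriv (fun x' => u x' t) y / 2))) := by
  have hd := hreg.differentiable two_ne_zero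
  have hslice : ∀ t, ContDiff ℝ 1 (fun x => u x t) := fun t =>
    (hreg.of_le one_le_two).comp (contDiff_id.prodMk contDiff_const)
  have hut : ∀ t, Differentiable ℝ (fun x => deriv (fun t' => u x t') t) := fun t => by
    simp only [fun a b => (hasDerivAt_snd_of_differentiable hd a b).deriv]
    have hd2 : Differentiable ℝ (fderiv ℝ (Function.uncurry u)) :=
      (hreg.fderiv_right (m := 1) (by norm_num)).differentiable one_ne_zero
    fun_prop
  have hmean : ∀ t, (∫ x in (0:ℝ)..1, Real.sinh (u x t)) = 0 := fun t => by
    rw [intervalIntegral.integral_eq_sub_of_hasDerivAt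
      (f := fun x => deriv (fun t' => u x t') t) (f' := fun x => Real.sinh (u x t))
      (fun x _ => by rw [← hpde]; exact (hut t x).hasDerivAt)
      ((Real.continuous_sinh.comp (hslice t).continuous).intervalIntegrable _ _)]
    have h : (fun t' => u 1 t') = fun t' => u 0 t' := by
      funext t'
      simpa using hper 0 t'
    simp only [h, sub_self]
  have hsol : ∀ x t, u x t = 2 * pInv (fun y => deriv (fun x' => u x' t) y / 2) x
      + cSh (fun y => deriv (fun x' => u x' t) y / 2) := fun x t => by
    rw [two_mul_pInv_half_deriv (hslice t), cSh_half_deriv (hslice t) (hmean t), sub_add_cancel]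
  refine ⟨hmean, fun t => ⟨?_, fun x => ?_, ?_⟩, hsol, fun x t => ?_⟩
  · exact ((hslice t).continuous_deriv le_rfl).div_const 2
  · have h := deriv_comp_add_const (fun x' => u x' t) 1 x
    simp only [hper] at h
    simp only [h]
  · rw [intervalIntegral.integral_div, intervalIntegral.integral_deriv_eq_sub
      (fun z _ => ((hslice t).differentiable one_ne_zero) z)
      (((hslice t).continuous_deriv le_rfl).intervalIntegrable _ _)]
    have h : u 1 t = u 0 t := by simpa using hper 0 t
    rw [h, sub_self, zero_div]
  · rw [← hsol, deriv_div_const, deriv_deriv_comm hreg, hpde]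
    ring
end

section
/- Let v, h: ℝ → ℝ be continuous, 1-periodic with ∫₀¹ v = ∫₀¹ h = 0, and define H_sh(w) := −¼ ∫₀¹ cosh( 2(∂ₓ⁻¹w)(x) + c_sh(w) ) dx for continuous 1-periodic mean-zero w. Then the function sinh(2∂ₓ⁻¹v + c_sh(v)) is continuous, 1-periodic with mean zero, the map ε ↦ H_sh(v + εh) is differentiable at ε = 0, and its derivative there equals ½ ∫₀¹ ( ∂ₓ⁻¹ sinh(2∂ₓ⁻¹v + c_sh(v)) )(x) · h(x) dx. -/
open MeasureTheory Real intervalIntegral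

/-- The Hamiltonian `H_sh(w) = -¼ ∫₀¹ cosh (2 ∂ₓ⁻¹w + c_sh(w))`. -/
noncomputable def HSh (w : ℝ → ℝ) : ℝ :=
  - (1 / 4) * ∫ x in (0:ℝ)..1, Real.cosh (2 * pInv w x + cSh w)

theorem hasDerivAt_pInv {f : ℝ → ℝ} (hf : Continuous f) (x : ℝ) :
    HasDerivAt (pInv f) (f x) x :=
  (hf.integral_hasStrictDerivAt 0 x).hasDerivAt.sub_const _

theorem continuous_pInv {f : ℝ → ℝ} (hf : Continuous f) : Continuous (pInv f) :=
  continuous_iff_continuousAt.2 fun x => (hasDerivAt_pInv hf x).continuousAt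

theorem pInv_periodic {f : ℝ → ℝ} (hf : Continuous f) (hp : Function.Periodic f 1)
    (h0 : (∫ x in (0:ℝ)..1, f x) = 0) : Function.Periodic (pInv f) 1 := fun x => by
  have h := hp.intervalIntegral_add_eq x 0
  rw [zero_add, h0] at h
  simp only [pInv]
  rw [← integral_add_adjacent_intervals (hf.intervalIntegrable 0 x)
    (hf.intervalIntegrable x (x + 1)), h, add_zero]

theorem pInv_add_mul {v h : ℝ → ℝ} (hv : Continuous v) (hh : Continuous h) (ε x : ℝ) :
    pInv (fun x => v x + ε * h x) x = pInv v x + ε * pInv h x := by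
  have hprim : ∀ y : ℝ, ∫ s in (0:ℝ)..y, (v s + ε * h s) =
      (∫ s in (0:ℝ)..y, v s) + ε * ∫ s in (0:ℝ)..y, h s := fun y => by
    rw [intervalIntegral.integral_add (hv.intervalIntegrable _ _)
      ((hh.const_mul ε).intervalIntegrable _ _), intervalIntegral.integral_const_mul]
  have hcv : Continuous fun y : ℝ => ∫ s in (0:ℝ)..y, v s :=
    continuous_primitive (fun _ _ => hv.intervalIntegrable _ _) 0
  have hch : Continuous fun y : ℝ => ∫ s in (0:ℝ)..y, h s :=
    continuous_primitive (fun _ _ => hh.intervalIntegrable _ _) 0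
  simp only [pInv, hprim]
  rw [intervalIntegral.integral_add (hcv.intervalIntegrable _ _)
    ((hch.const_mul ε).intervalIntegrable _ _), intervalIntegral.integral_const_mul]
  ring

/-- `∂ₓ⁻¹` is skew-adjoint on continuous periodic mean-zero functions. -/
theorem integral_pInv_mul {f g : ℝ → ℝ}
    (hf : Continuous f) (hfp : Function.Periodic f 1) (hf0 : (∫ x in (0:ℝ)..1, f x) = 0)
    (hg : Continuous g) (hgp : Function.Periodic g 1) (hg0 : (∫ x in (0:ℝ)..1, g x) = 0) :
    ∫ x in (0:ℝ)..1, pInv f x * g x = -∫ x in (0:ℝ)..1, f x * pInv g x := by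
  have hf1 := pInv_periodic hf hfp hf0 0
  have hg1 := pInv_periodic hg hgp hg0 0
  rw [zero_add] at hf1 hg1
  rw [integral_mul_deriv_eq_deriv_mul (fun x _ => hasDerivAt_pInv hf x)
    (fun x _ => hasDerivAt_pInv hg x) (hf.intervalIntegrable _ _) (hg.intervalIntegrable _ _),
    hf1, hg1]
  ring

theorem hasDerivAt_integral_exp_add_mul {f g : ℝ → ℝ} (hf : Continuous f) (hg : Continuous g) :
    HasDerivAt (fun ε : ℝ => ∫ x in (0:ℝ)..1, rexp (f x + ε * g x))
      (∫ x in (0:ℝ)..1, g x * rexp (f x)) 0 := by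
  have h := (hasDerivAt_integral_of_dominated_loc_of_deriv_le (μ := volume) (a := 0) (b := 1)
    (F := fun ε x => rexp (f x + ε * g x)) (F' := fun ε x => g x * rexp (f x + ε * g x))
    (x₀ := (0:ℝ)) (bound := fun x => |g x| * rexp (f x + |g x|))
    (Metric.ball_mem_nhds (0:ℝ) one_pos)
    (.of_forall fun ε => Continuous.aestronglyMeasurable (by fun_prop))
    (Continuous.intervalIntegrable (by fun_prop) _ _)
    (Continuous.aestronglyMeasurable (by fun_prop))
    (.of_forall fun x _ ε hε => ?_)
    (Continuous.intervalIntegrable (by fun_prop) _ _)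
    (.of_forall fun x _ ε _ => ?_)).2
  · simpa using h
  · rw [mem_ball_zero_iff, Real.norm_eq_abs] at hε
    rw [Real.norm_eq_abs, abs_mul, Real.abs_exp]
    have hle : ε * g x ≤ |g x| := (le_abs_self _).trans <| by
      rw [abs_mul]
      exact mul_le_of_le_one_left (abs_nonneg _) hε.le
    gcongr
  · simpa [mul_comm] using (((hasDerivAt_id ε).mul_const (g x)).const_add (f x)).exp

theorem integral_exp_pos {f : ℝ → ℝ} (hf : Continuous f) :
    0 < ∫ x in (0:ℝ)..1, rexp (f x) :=
  intervalIntegral_pos_of_pos (Continuous.intervalIntegrable (by fun_prop) _ _)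
    (fun _ => Real.exp_pos _) one_pos

theorem cSh_eq_log {v : ℝ → ℝ} (hv : Continuous v) :
    cSh v = 1 / 2 * Real.log ((∫ x in (0:ℝ)..1, rexp (-2 * pInv v x)) /
      ∫ x in (0:ℝ)..1, rexp (2 * pInv v x)) := by
  have hV := continuous_pInv hv
  have hApos := integral_exp_pos (hV.const_mul 2)
  have hBpos := integral_exp_pos (hV.const_mul (-2))
  have hiA : IntervalIntegrable (fun x => rexp (2 * pInv v x)) volume 0 1 :=
    Continuous.intervalIntegrable (by fun_prop) _ _
  have hiB : IntervalIntegrable (fun x => rexp (-2 * pInv v x)) volume 0 1 :=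
    Continuous.intervalIntegrable (by fun_prop) _ _
  have hs : ∫ x in (0:ℝ)..1, Real.sinh (2 * pInv v x) =
      ((∫ x in (0:ℝ)..1, rexp (2 * pInv v x)) - ∫ x in (0:ℝ)..1, rexp (-2 * pInv v x)) / 2 := by
    rw [← intervalIntegral.integral_sub hiA hiB, ← intervalIntegral.integral_div]
    simp only [Real.sinh_eq, neg_mul]
  have hc : ∫ x in (0:ℝ)..1, Real.cosh (2 * pInv v x) =
      ((∫ x in (0:ℝ)..1, rexp (2 * pInv v x)) + ∫ x in (0:ℝ)..1, rexp (-2 * pInv v x)) / 2 := by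
    rw [← intervalIntegral.integral_add hiA hiB, ← intervalIntegral.integral_div]
    simp only [Real.cosh_eq, neg_mul]
  rw [cSh, _root_.artanh, hs, hc]
  set A := ∫ x in (0:ℝ)..1, rexp (2 * pInv v x)
  set B := ∫ x in (0:ℝ)..1, rexp (-2 * pInv v x)
  have hsum : A + B ≠ 0 := (add_pos hApos hBpos).ne'
  have hnum : 1 + (A - B) / 2 / ((A + B) / 2) = 2 * A / (A + B) := by field_simp; ring
  have hden : 1 - (A - B) / 2 / ((A + B) / 2) = 2 * B / (A + B) := by field_simp; ring
  have hratio : (1 + (A - B) / 2 / ((A + B) / 2)) / (1 - (A - B) / 2 / ((A + B) / 2)) =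
      (B / A)⁻¹ := by
    rw [hnum, hden]
    field_simp
  rw [hratio, Real.log_inv]
  ring

theorem exp_cSh {v : ℝ → ℝ} (hv : Continuous v) :
    rexp (cSh v) = √((∫ x in (0:ℝ)..1, rexp (2 * pInv v x)) *
      ∫ x in (0:ℝ)..1, rexp (-2 * pInv v x)) / ∫ x in (0:ℝ)..1, rexp (2 * pInv v x) := by
  have hV := continuous_pInv hv
  have hApos := integral_exp_pos (hV.const_mul 2)
  have hBpos := integral_exp_pos (hV.const_mul (-2))
  rw [cSh_eq_log hv, mul_comm, Real.exp_mul, Real.exp_log (div_pos hBpos hApos),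
    ← Real.sqrt_eq_rpow]
  set A := ∫ x in (0:ℝ)..1, rexp (2 * pInv v x)
  rw [Real.sqrt_eq_iff_mul_self_eq (by positivity) (by positivity), div_mul_div_comm,
    Real.mul_self_sqrt (by positivity)]
  field_simp

theorem exp_neg_cSh {v : ℝ → ℝ} (hv : Continuous v) :
    rexp (-cSh v) = √((∫ x in (0:ℝ)..1, rexp (2 * pInv v x)) *
      ∫ x in (0:ℝ)..1, rexp (-2 * pInv v x)) / ∫ x in (0:ℝ)..1, rexp (-2 * pInv v x) := by
  have hV := continuous_pInv hv
  have hApos := integral_exp_pos (hV.const_mul 2)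
  have hBpos := integral_exp_pos (hV.const_mul (-2))
  have hs := Real.sqrt_pos.2 (mul_pos hApos hBpos)
  have hsq := Real.mul_self_sqrt (mul_pos hApos hBpos).le
  rw [Real.exp_neg, exp_cSh hv, inv_div, div_eq_div_iff hs.ne' hBpos.ne', hsq]

theorem integral_exp_add_const (f : ℝ → ℝ) (c : ℝ) :
    ∫ x in (0:ℝ)..1, rexp (f x + c) = (∫ x in (0:ℝ)..1, rexp (f x)) * rexp c := by
  simp only [Real.exp_add, intervalIntegral.integral_mul_const]

theorem integral_exp_add_cSh {v : ℝ → ℝ} (hv : Continuous v) :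
    ∫ x in (0:ℝ)..1, rexp (2 * pInv v x + cSh v) =
      √((∫ x in (0:ℝ)..1, rexp (2 * pInv v x)) * ∫ x in (0:ℝ)..1, rexp (-2 * pInv v x)) := by
  have hApos := integral_exp_pos ((continuous_pInv hv).const_mul 2)
  rw [integral_exp_add_const, exp_cSh hv, mul_div_cancel₀ _ hApos.ne']

theorem integral_exp_neg_add_cSh {v : ℝ → ℝ} (hv : Continuous v) :
    ∫ x in (0:ℝ)..1, rexp (-(2 * pInv v x + cSh v)) =
      √((∫ x in (0:ℝ)..1, rexp (2 * pInv v x)) * ∫ x in (0:ℝ)..1, rexp (-2 * pInv v x)) := by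
  have hBpos := integral_exp_pos ((continuous_pInv hv).const_mul (-2))
  simp only [neg_add, ← neg_mul]
  rw [integral_exp_add_const, exp_neg_cSh hv, mul_div_cancel₀ _ hBpos.ne']

theorem integral_sinh_add_cSh {v : ℝ → ℝ} (hv : Continuous v) :
    ∫ x in (0:ℝ)..1, Real.sinh (2 * pInv v x + cSh v) = 0 := by
  have hV := continuous_pInv hv
  simp only [Real.sinh_eq]
  rw [intervalIntegral.integral_div, intervalIntegral.integral_sub
    (Continuous.intervalIntegrable (by fun_prop) _ _)
    (Continuous.intervalIntegrable (by fun_prop) _ _),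
    integral_exp_add_cSh hv, integral_exp_neg_add_cSh hv, sub_self, zero_div]

/-- `H_sh(w) = -¼ √(∫₀¹ exp (2 ∂ₓ⁻¹w) · ∫₀¹ exp (-2 ∂ₓ⁻¹w))`. -/
theorem HSh_eq_sqrt {w : ℝ → ℝ} (hw : Continuous w) :
    HSh w = -(1 / 4) * √((∫ x in (0:ℝ)..1, rexp (2 * pInv w x)) *
      ∫ x in (0:ℝ)..1, rexp (-2 * pInv w x)) := by
  have hW := continuous_pInv hw
  simp only [HSh, Real.cosh_eq]
  rw [intervalIntegral.integral_div, intervalIntegral.integral_add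
    (Continuous.intervalIntegrable (by fun_prop) _ _)
    (Continuous.intervalIntegrable (by fun_prop) _ _),
    integral_exp_add_cSh hw, integral_exp_neg_add_cSh hw, add_self_div_two]

/-- the function `sinh (2 ∂ₓ⁻¹v + c_sh(v))` is continuous, 1-periodic and mean
zero, and the directional derivative of `H_sh` at `v` in direction `h` equals
`½ ∫₀¹ (∂ₓ⁻¹ sinh (2 ∂ₓ⁻¹v + c_sh(v))) (x) * h x dx`. -/
theorem hSh_gradient (v h : ℝ → ℝ)
    (hv : Continuous v) (hvp : Function.Periodic v 1) (hv0 : (∫ x in (0:ℝ)..1, v x) = 0)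
    (hh : Continuous h) (hhp : Function.Periodic h 1) (hh0 : (∫ x in (0:ℝ)..1, h x) = 0) :
    (Continuous (fun x => Real.sinh (2 * pInv v x + cSh v)) ∧
      Function.Periodic (fun x => Real.sinh (2 * pInv v x + cSh v)) 1 ∧
      (∫ x in (0:ℝ)..1, Real.sinh (2 * pInv v x + cSh v)) = 0) ∧
    HasDerivAt (fun ε : ℝ => HSh (fun x => v x + ε * h x))
      ((1 / 2) * ∫ x in (0:ℝ)..1,
        pInv (fun y => Real.sinh (2 * pInv v y + cSh v)) x * h x) 0 := by
  have hV := continuous_pInv hv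
  have hK := continuous_pInv hh
  have hper : Function.Periodic (fun x => Real.sinh (2 * pInv v x + cSh v)) 1 := fun x => by
    simp only [pInv_periodic hv hvp hv0 x]
  have hcont : Continuous (fun x => Real.sinh (2 * pInv v x + cSh v)) := by fun_prop
  have hmean := integral_sinh_add_cSh hv
  refine ⟨⟨hcont, hper, hmean⟩, ?_⟩
  rw [integral_pInv_mul hcont hper hmean hh hhp hh0]
  have hA := hasDerivAt_integral_exp_add_mul (hV.const_mul 2) (hK.const_mul 2)
  have hB := hasDerivAt_integral_exp_add_mul (hV.const_mul (-2)) (hK.const_mul (-2))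
  have hApos := integral_exp_pos (hV.const_mul 2)
  have hBpos := integral_exp_pos (hV.const_mul (-2))
  have hH : (fun ε : ℝ => HSh (fun x => v x + ε * h x)) = fun ε =>
      -(1 / 4) * √((∫ x in (0:ℝ)..1, rexp (2 * pInv v x + ε * (2 * pInv h x))) *
        ∫ x in (0:ℝ)..1, rexp (-2 * pInv v x + ε * (-2 * pInv h x))) := by
    funext ε
    rw [HSh_eq_sqrt (hv.fun_add (hh.const_mul ε))]
    simp only [pInv_add_mul hv hh, mul_add, mul_left_comm ε]
  rw [hH]
  have hAB := ((hA.fun_mul hB).sqrt (by simpa using (mul_pos hApos hBpos).ne')).const_mul (-(1 / 4))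
  refine hAB.congr_deriv (Eq.symm ?_)
  have hsplit : ∫ x in (0:ℝ)..1, Real.sinh (2 * pInv v x + cSh v) * pInv h x =
      rexp (cSh v) / 4 * (∫ x in (0:ℝ)..1, 2 * pInv h x * rexp (2 * pInv v x)) +
      rexp (-cSh v) / 4 * ∫ x in (0:ℝ)..1, -2 * pInv h x * rexp (-2 * pInv v x) := by
    rw [← intervalIntegral.integral_const_mul, ← intervalIntegral.integral_const_mul,
      ← intervalIntegral.integral_add (Continuous.intervalIntegrable (by fun_prop) _ _)
        (Continuous.intervalIntegrable (by fun_prop) _ _)]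
    refine intervalIntegral.integral_congr fun x _ => ?_
    simp only [Real.sinh_eq, neg_add, Real.exp_add, neg_mul]
    ring
  rw [hsplit, exp_cSh hv, exp_neg_cSh hv]
  simp only [zero_mul, add_zero]
  have hs := Real.sqrt_pos.2 (mul_pos hApos hBpos)
  have hsq := Real.sq_sqrt (mul_pos hApos hBpos).le
  generalize √_ = S at hs hsq ⊢
  generalize (∫ x in (0:ℝ)..1, rexp (2 * pInv v x)) = A at hApos hsq ⊢
  generalize (∫ x in (0:ℝ)..1, rexp (-2 * pInv v x)) = B at hBpos hsq ⊢
  field_simp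
  rw [hsq]
end
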